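/- arXiv:1701.03435 — 2 statements merged into one kernel-verified Lean document; each statement's English description precedes it below -/
import Mathlib

section
/- Let σ be a type and let U be a ℚ[t]-subalgebra of MvPolynomial σ ℚ[t]. Then the set {in(f) : f ∈ U, f ≠ 0} ∪ {0} is a ℚ-subalgebra of MvPolynomial σ ℚ (it contains 1, is closed under addition, multiplication, and multiplication by rational scalars). Consequently this set equals the initial algebra in(U), i.e. the ℚ-subalgebra of MvPolynomial σ ℚ generated by the initial forms in(f) of all nonzero f ∈ U. -/
open Polynomial

/-- The t-adic valuation of the ℚ[t]-coefficient of minimal valuation of a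
multivariate polynomial over ℚ[t]. -/
noncomputable def omega0 {σ : Type*} (f : MvPolynomial σ ℚ[X]) : ℕ :=
  sInf ((fun m => (f.coeff m).rootMultiplicity 0) '' ↑f.support)

/-- The initial form of `f`: the coefficient at each monomial is the coefficient of
`t ^ ω₀(f)` in the corresponding ℚ[t]-coefficient of `f`. -/
noncomputable def initForm {σ : Type*} (f : MvPolynomial σ ℚ[X]) : MvPolynomial σ ℚ :=
  ∑ m ∈ f.support, MvPolynomial.monomial m ((f.coeff m).coeff (omega0 f))

/-- The set of initial forms of nonzero elements of `U`, together with `0`. -/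
def initSet {σ : Type*} (U : Subalgebra ℚ[X] (MvPolynomial σ ℚ[X])) : Set (MvPolynomial σ ℚ) :=
  {g | ∃ f ∈ U, f ≠ 0 ∧ g = initForm f} ∪ {0}

theorem coeff_initForm_aux {σ : Type*} (f : MvPolynomial σ ℚ[X]) (m : σ →₀ ℕ) :
    (initForm f).coeff m = (f.coeff m).coeff (omega0 f) := by
  classical
  unfold initForm
  rw [MvPolynomial.coeff_sum]
  simp only [MvPolynomial.coeff_monomial]
  rw [Finset.sum_ite_eq']
  split_ifs with h
  · rfl
  · rw [MvPolynomial.notMem_support_iff.mp h]; simp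

theorem initForm_eq_map_aux {σ : Type*} (f h : MvPolynomial σ ℚ[X])
    (e : f = MvPolynomial.C (X ^ omega0 f) * h) :
    initForm f = MvPolynomial.map (Polynomial.evalRingHom 0) h := by
  ext m
  rw [coeff_initForm_aux, MvPolynomial.coeff_map]
  have h1 : f.coeff m = X ^ omega0 f * h.coeff m := by
    conv_lhs => rw [e]
    rw [MvPolynomial.coeff_C_mul]
  rw [h1, Polynomial.coeff_X_pow_mul']
  simp [Polynomial.coeff_zero_eq_eval_zero]

theorem X_pow_dvd_iff_aux (p : ℚ[X]) (hp : p ≠ 0) (n : ℕ) :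
    n ≤ p.rootMultiplicity 0 ↔ X ^ n ∣ p := by
  rw [Polynomial.le_rootMultiplicity_iff hp]; simp

theorem exists_factor_aux {σ : Type*} (f : MvPolynomial σ ℚ[X]) :
    ∃ h, f = MvPolynomial.C (X ^ omega0 f) * h := by
  have : MvPolynomial.C (X ^ omega0 f) ∣ f := by
    rw [MvPolynomial.C_dvd_iff_dvd_coeff]
    intro m
    by_cases hm : f.coeff m = 0
    · rw [hm]; exact dvd_zero _
    · rw [← X_pow_dvd_iff_aux _ hm]
      exact Nat.sInf_le ⟨m, by simpa using hm, rfl⟩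
  exact this

theorem omega0_eq_aux {σ : Type*} (n : ℕ) (h : MvPolynomial σ ℚ[X])
    (hh : MvPolynomial.map (Polynomial.evalRingHom 0) h ≠ 0) :
    omega0 (MvPolynomial.C (X ^ n) * h) = n := by
  obtain ⟨m, hm⟩ := MvPolynomial.ne_zero_iff.mp hh
  rw [MvPolynomial.coeff_map] at hm
  have hm' : (h.coeff m).coeff 0 ≠ 0 := by
    simpa [Polynomial.coeff_zero_eq_eval_zero] using hm
  have hm0 : h.coeff m ≠ 0 := by
    intro h0; rw [h0] at hm'; simp at hm'
  have hne : (MvPolynomial.C (X ^ n) * h).coeff m ≠ 0 := by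
    rw [MvPolynomial.coeff_C_mul]
    exact mul_ne_zero (pow_ne_zero _ X_ne_zero) hm0
  apply le_antisymm
  · have h1 : omega0 (MvPolynomial.C (X ^ n) * h) ≤
        ((MvPolynomial.C (X ^ n) * h).coeff m).rootMultiplicity 0 :=
      Nat.sInf_le ⟨m, by simpa using hne, rfl⟩
    refine h1.trans ?_
    by_contra hlt
    have h2 : n + 1 ≤ ((MvPolynomial.C (X ^ n) * h).coeff m).rootMultiplicity 0 := by omega
    rw [X_pow_dvd_iff_aux _ hne, MvPolynomial.coeff_C_mul, pow_succ,
      mul_dvd_mul_iff_left (pow_ne_zero _ X_ne_zero), Polynomial.X_dvd_iff] at h2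
    exact hm' h2
  · refine le_csInf ⟨_, m, by simpa using hne, rfl⟩ ?_
    rintro _ ⟨k, hk, rfl⟩
    have hk' : (MvPolynomial.C (X ^ n) * h).coeff k ≠ 0 :=
      MvPolynomial.mem_support_iff.mp hk
    show n ≤ _
    rw [X_pow_dvd_iff_aux _ hk', MvPolynomial.coeff_C_mul]
    exact dvd_mul_right _ _

theorem mem_initSet_aux {σ : Type*} (U : Subalgebra ℚ[X] (MvPolynomial σ ℚ[X]))
    (g : MvPolynomial σ ℚ) : g ∈ initSet U ↔ ∃ (n : ℕ) (h : MvPolynomial σ ℚ[X]),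
      MvPolynomial.C (X ^ n) * h ∈ U ∧ MvPolynomial.map (Polynomial.evalRingHom 0) h = g := by
  constructor
  · rintro (⟨f, hf, -, rfl⟩ | h0)
    · obtain ⟨h, e⟩ := exists_factor_aux f
      exact ⟨omega0 f, h, e ▸ hf, (initForm_eq_map_aux f h e).symm⟩
    · exact ⟨0, 0, by simp, by simpa using (Set.mem_singleton_iff.mp h0).symm⟩
  · rintro ⟨n, h, hU, rfl⟩
    by_cases hh : MvPolynomial.map (Polynomial.evalRingHom 0) h = 0
    · exact Or.inr hh
    · refine Or.inl ⟨_, hU, ?_, ?_⟩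
      · refine mul_ne_zero ?_ ?_
        · rw [Ne, MvPolynomial.C_eq_zero]; exact pow_ne_zero _ X_ne_zero
        · rintro rfl; exact hh (map_zero _)
      · exact (initForm_eq_map_aux _ h (by rw [omega0_eq_aux n h hh])).symm

theorem C_mul_mem_aux {σ : Type*} (U : Subalgebra ℚ[X] (MvPolynomial σ ℚ[X]))
    (p : ℚ[X]) {f : MvPolynomial σ ℚ[X]} (hf : f ∈ U) : MvPolynomial.C p * f ∈ U := by
  rw [← MvPolynomial.smul_eq_C_mul]; exact U.smul_mem hf p

theorem initSet_is_initial_algebra {σ : Type*} (U : Subalgebra ℚ[X] (MvPolynomial σ ℚ[X])) :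
    (1 : MvPolynomial σ ℚ) ∈ initSet U ∧
    (∀ a ∈ initSet U, ∀ b ∈ initSet U, a + b ∈ initSet U) ∧
    (∀ a ∈ initSet U, ∀ b ∈ initSet U, a * b ∈ initSet U) ∧
    (∀ q : ℚ, ∀ a ∈ initSet U, q • a ∈ initSet U) ∧
    (Algebra.adjoin ℚ {g : MvPolynomial σ ℚ | ∃ f ∈ U, f ≠ 0 ∧ g = initForm f} :
        Set (MvPolynomial σ ℚ)) = initSet U := by
  have h1 : (1 : MvPolynomial σ ℚ) ∈ initSet U :=
    (mem_initSet_aux U _).mpr ⟨0, 1, by simpa using U.one_mem, map_one _⟩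
  have hadd : ∀ a ∈ initSet U, ∀ b ∈ initSet U, a + b ∈ initSet U := by
    intro a ha b hb
    obtain ⟨n, f, hf, rfl⟩ := (mem_initSet_aux U _).mp ha
    obtain ⟨k, g, hg, rfl⟩ := (mem_initSet_aux U _).mp hb
    refine (mem_initSet_aux U _).mpr ⟨n + k, f + g, ?_, map_add _ _ _⟩
    have := U.add_mem (C_mul_mem_aux U (X ^ k) hf) (C_mul_mem_aux U (X ^ n) hg)
    convert this using 1
    rw [pow_add, map_mul]; ring
  have hmul : ∀ a ∈ initSet U, ∀ b ∈ initSet U, a * b ∈ initSet U := by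
    intro a ha b hb
    obtain ⟨n, f, hf, rfl⟩ := (mem_initSet_aux U _).mp ha
    obtain ⟨k, g, hg, rfl⟩ := (mem_initSet_aux U _).mp hb
    refine (mem_initSet_aux U _).mpr ⟨n + k, f * g, ?_, map_mul _ _ _⟩
    have := U.mul_mem hf hg
    convert this using 1
    rw [pow_add, map_mul]; ring
  have hsmul : ∀ q : ℚ, ∀ a ∈ initSet U, q • a ∈ initSet U := by
    intro q a ha
    obtain ⟨n, f, hf, rfl⟩ := (mem_initSet_aux U _).mp ha
    refine (mem_initSet_aux U _).mpr
      ⟨n, MvPolynomial.C (Polynomial.C q) * f, ?_, ?_⟩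
    · have := C_mul_mem_aux U (Polynomial.C q) hf
      convert this using 1
      ring
    · rw [map_mul, MvPolynomial.map_C, MvPolynomial.smul_eq_C_mul]; simp
  refine ⟨h1, hadd, hmul, hsmul, ?_⟩
  apply Set.Subset.antisymm
  · intro x hx
    induction hx using Algebra.adjoin_induction with
    | mem x hx => exact Or.inl hx
    | algebraMap r => rw [Algebra.algebraMap_eq_smul_one]; exact hsmul r 1 h1
    | add x y _ _ hx hy => exact hadd x hx y hy
    | mul x y _ _ hx hy => exact hmul x hx y hy
  · rintro x (hx | hx)
    · exact Algebra.subset_adjoin hx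
    · rw [Set.mem_singleton_iff.mp hx]; exact Subalgebra.zero_mem _
end

section
/- Let G and G' be the explicit 3×6 matrices over ℚ[t] defined in the context, and let G₆(M) ∈ MvPolynomial (Fin 6 ⊕ Fin 6) ℚ[t] (variables x₁,…,x₆, y₁,…,y₆) be the conic generator defined by the explicit 16-term formula in the context, with p_{ijk} the 3×3 minors of M. Then: (a) the initial form in(G₆(G)) is a nonzero rational multiple of the single monomial x₁x₃x₄x₅x₆y₂y₆ (in particular it is a monomial); (b) the support of the initial form in(G₆(G')) consists of exactly the three monomials x₆²x₁x₄x₅y₂y₃, x₁x₃x₄x₅x₆y₂y₆, and x₁x₂x₃x₄x₅y₆² (in particular it is not a monomial). Hence the subspace determined by G' is not moneric while the generator G₆ of G has monomial initial form. -/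
open Polynomial

/-- The matrix `G` from Example `example_comp_tgr`. -/
noncomputable def Gmat : Matrix (Fin 3) (Fin 6) ℚ[X] :=
  !![X^4,  X,   X^8, X^3, X^9,  1;
     X^11, X^7, X,   X^7, X^6,  1;
     X^9,  1,   X^5, X^9, X^11, X^6]

/-- The matrix `G'`, obtained from `G` by changing the sign of the (1,4) entry. -/
noncomputable def Gmat' : Matrix (Fin 3) (Fin 6) ℚ[X] :=
  !![X^4,  X,   X^8, -X^3, X^9,  1;
     X^11, X^7, X,   X^7,  X^6,  1;
     X^9,  1,   X^5, X^9,  X^11, X^6]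

/-- The 3×3 minor of a 3×6 matrix on columns `i, j, k` (Plücker coordinate). -/
noncomputable def plucker (M : Matrix (Fin 3) (Fin 6) ℚ[X]) (i j k : Fin 6) : ℚ[X] :=
  (M.submatrix id ![i, j, k]).det

/-- The variable `xᵢ` of the Cox–Nagata ring. -/
noncomputable def xv (i : Fin 6) : MvPolynomial (Fin 6 ⊕ Fin 6) ℚ[X] :=
  MvPolynomial.X (Sum.inl i)

/-- The variable `yᵢ` of the Cox–Nagata ring. -/
noncomputable def yv (i : Fin 6) : MvPolynomial (Fin 6 ⊕ Fin 6) ℚ[X] :=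
  MvPolynomial.X (Sum.inr i)

/-- The Plücker coordinate `p i j k` of `M` viewed as a constant of the Cox–Nagata ring. -/
noncomputable def cf (M : Matrix (Fin 3) (Fin 6) ℚ[X]) (i j k : Fin 6) :
    MvPolynomial (Fin 6 ⊕ Fin 6) ℚ[X] :=
  MvPolynomial.C (plucker M i j k)

/-- The conic generator `G₆` of the Cox ring (all indices 0-indexed: the paper's
`x₁,…,x₆,y₁,…,y₆,p_{ijk}` are `xv 0,…,xv 5, yv 0,…,yv 5, cf M (i-1) (j-1) (k-1)`). -/
noncomputable def conicGen (M : Matrix (Fin 3) (Fin 6) ℚ[X]) :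
    MvPolynomial (Fin 6 ⊕ Fin 6) ℚ[X] :=
  cf M 0 1 2 * cf M 0 1 3 * cf M 0 1 4 * cf M 2 3 4 * (yv 0 * yv 1 * xv 2 * xv 3 * xv 4 * xv 5^2) +
  cf M 0 1 2 * cf M 0 2 4 * cf M 0 2 3 * cf M 1 3 4 * (yv 0 * yv 2 * xv 1 * xv 3 * xv 4 * xv 5^2) +
  cf M 0 1 3 * cf M 0 2 3 * cf M 0 3 4 * cf M 1 2 4 * (yv 0 * yv 3 * xv 1 * xv 2 * xv 4 * xv 5^2) +
  cf M 0 1 4 * cf M 0 2 4 * cf M 0 3 4 * cf M 1 2 3 * (yv 0 * yv 4 * xv 1 * xv 2 * xv 3 * xv 5^2) +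
  cf M 0 1 2 * cf M 1 2 3 * cf M 1 2 4 * cf M 0 3 4 * (yv 1 * yv 2 * xv 0 * xv 3 * xv 4 * xv 5^2) +
  cf M 0 1 3 * cf M 1 2 3 * cf M 1 3 4 * cf M 0 2 4 * (yv 1 * yv 3 * xv 0 * xv 2 * xv 4 * xv 5^2) +
  cf M 0 1 4 * cf M 1 2 4 * cf M 1 3 4 * cf M 0 2 3 * (yv 1 * yv 4 * xv 0 * xv 2 * xv 3 * xv 5^2) +
  cf M 0 2 3 * cf M 1 2 3 * cf M 2 3 4 * cf M 0 1 4 * (yv 2 * yv 3 * xv 0 * xv 1 * xv 4 * xv 5^2) +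
  cf M 0 2 4 * cf M 1 2 4 * cf M 2 3 4 * cf M 0 1 3 * (yv 2 * yv 4 * xv 0 * xv 1 * xv 3 * xv 5^2) +
  cf M 0 3 4 * cf M 1 3 4 * cf M 2 3 4 * cf M 0 1 2 * (yv 3 * yv 4 * xv 0 * xv 1 * xv 2 * xv 5^2) +
  (cf M 0 1 3 * cf M 1 2 4 * cf M 0 2 5 * cf M 0 3 4 -
     cf M 0 1 2 * cf M 1 3 4 * cf M 0 3 5 * cf M 0 2 4) *
    (yv 0 * yv 5 * xv 1 * xv 2 * xv 3 * xv 4 * xv 5) +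
  (cf M 0 1 3 * cf M 0 2 4 * cf M 1 2 5 * cf M 1 3 4 -
     cf M 0 1 2 * cf M 0 3 4 * cf M 1 3 5 * cf M 1 2 4) *
    (yv 1 * yv 5 * xv 0 * xv 2 * xv 3 * xv 4 * xv 5) +
  (cf M 0 2 3 * cf M 0 1 4 * cf M 1 2 5 * cf M 2 3 4 +
     cf M 0 1 2 * cf M 0 3 4 * cf M 2 3 5 * cf M 1 2 4) *
    (yv 2 * yv 5 * xv 0 * xv 1 * xv 3 * xv 4 * xv 5) +
  (cf M 0 1 3 * cf M 0 2 4 * cf M 2 3 5 * cf M 1 3 4 -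
     cf M 0 2 3 * cf M 0 1 4 * cf M 1 3 5 * cf M 2 3 4) *
    (yv 3 * yv 5 * xv 0 * xv 1 * xv 2 * xv 4 * xv 5) +
  (cf M 0 1 4 * cf M 0 2 3 * cf M 2 4 5 * cf M 1 3 4 -
     cf M 0 2 4 * cf M 0 1 3 * cf M 1 4 5 * cf M 2 3 4) *
    (yv 4 * yv 5 * xv 0 * xv 1 * xv 2 * xv 3 * xv 5) +
  (cf M 0 1 3 * cf M 0 2 4 * cf M 1 2 5 * cf M 3 4 5 -
     cf M 0 1 2 * cf M 0 3 4 * cf M 1 3 5 * cf M 2 4 5) *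
    (yv 5^2 * xv 0 * xv 1 * xv 2 * xv 3 * xv 4)

/-- The variable `xᵢ` over the residue field ℚ. -/
noncomputable def xq (i : Fin 6) : MvPolynomial (Fin 6 ⊕ Fin 6) ℚ :=
  MvPolynomial.X (Sum.inl i)

/-- The variable `yᵢ` over the residue field ℚ. -/
noncomputable def yq (i : Fin 6) : MvPolynomial (Fin 6 ⊕ Fin 6) ℚ :=
  MvPolynomial.X (Sum.inr i)


set_option linter.unusedSimpArgs false

/-- The family `G_s` containing both `G` and `G'`. -/
noncomputable def GS (s : ℚ) : Matrix (Fin 3) (Fin 6) ℚ[X] :=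
  !![X^4,  X,   X^8, C s * X^3, X^9,  1;
     X^11, X^7, X,   X^7, X^6,  1;
     X^9,  1,   X^5, X^9, X^11, X^6]

/-- `p = t^N (c + d t + O(t^2))`. -/
def LeadT (p : ℚ[X]) (N : ℕ) (c d : ℚ) : Prop :=
  ∃ r : ℚ[X], p = X ^ N * (C c + C d * X + X ^ 2 * r)

theorem LeadT.mul {p q : ℚ[X]} {N M : ℕ} {c d c' d' : ℚ} (h : LeadT p N c d) (h' : LeadT q M c' d') :
    LeadT (p * q) (N + M) (c * c') (c * d' + d * c') := by
  obtain ⟨r, rfl⟩ := h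
  obtain ⟨r', rfl⟩ := h'
  refine ⟨C c * r' + r * C c' + C d * C d' + X * (C d * r' + r * C d') + X ^ 2 * (r * r'), ?_⟩
  simp only [map_mul, map_add]
  ring

theorem LeadT.sub {p q : ℚ[X]} {N : ℕ} {c d c' d' : ℚ} (h : LeadT p N c d) (h' : LeadT q N c' d') :
    LeadT (p - q) N (c - c') (d - d') := by
  obtain ⟨r, rfl⟩ := h
  obtain ⟨r', rfl⟩ := h'
  refine ⟨r - r', ?_⟩
  simp only [map_sub]
  ring

theorem LeadT.add {p q : ℚ[X]} {N : ℕ} {c d c' d' : ℚ} (h : LeadT p N c d) (h' : LeadT q N c' d') :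
    LeadT (p + q) N (c + c') (d + d') := by
  obtain ⟨r, rfl⟩ := h
  obtain ⟨r', rfl⟩ := h'
  refine ⟨r + r', ?_⟩
  simp only [map_add]
  ring

theorem LeadT.weak {p : ℚ[X]} {N : ℕ} {c d : ℚ} (h : LeadT p N c d) (M : ℕ) (hM : M + 2 ≤ N) :
    LeadT p M 0 0 := by
  obtain ⟨k, rfl⟩ := Nat.exists_eq_add_of_le hM
  obtain ⟨r, rfl⟩ := h
  refine ⟨X ^ k * (C c + C d * X + X ^ 2 * r), ?_⟩
  simp only [map_zero]
  ring

theorem LeadT.weak1 {p : ℚ[X]} {N : ℕ} {c d : ℚ} (h : LeadT p N c d) (M : ℕ) (hM : N = M + 1) :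
    LeadT p M 0 c := by
  subst hM
  obtain ⟨r, rfl⟩ := h
  refine ⟨C d + X * r, ?_⟩
  simp only [map_zero]
  ring

theorem LeadT.cast {p : ℚ[X]} {N : ℕ} {c d : ℚ} (h : LeadT p N c d) (M : ℕ) (hM : N = M) :
    LeadT p M c d := hM ▸ h

theorem plucker_GS (s : ℚ) (i j k : Fin 6) : plucker (GS s) i j k =
    GS s 0 i * GS s 1 j * GS s 2 k - GS s 0 i * GS s 1 k * GS s 2 j
    - GS s 0 j * GS s 1 i * GS s 2 k + GS s 0 j * GS s 1 k * GS s 2 i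
    + GS s 0 k * GS s 1 i * GS s 2 j - GS s 0 k * GS s 1 j * GS s 2 i := by
  simp [plucker, Matrix.det_fin_three]

theorem init_of {σ : Type*} (N : ℕ) (f g : MvPolynomial σ ℚ[X]) (h : MvPolynomial σ ℚ)
    (hf : f = MvPolynomial.C (X ^ N) * g) (hg : MvPolynomial.map constantCoeff g = h)
    (hh : h ≠ 0) : initForm f = h := by
  classical
  have hc : ∀ m, f.coeff m = X ^ N * g.coeff m := fun m => by
    rw [hf, MvPolynomial.coeff_C_mul]
  have hgc : ∀ m, h.coeff m = (g.coeff m).coeff 0 := fun m => by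
    rw [← hg, MvPolynomial.coeff_map]; rfl
  have hrm : ∀ p : ℚ[X], p ≠ 0 → (X ^ N * p).rootMultiplicity 0 = N + p.rootMultiplicity 0 := by
    intro p hp
    have hX : (X : ℚ[X]) ^ N = (X - C 0) ^ N := by simp
    rw [rootMultiplicity_mul (mul_ne_zero (pow_ne_zero _ X_ne_zero) hp), hX,
      rootMultiplicity_X_sub_C_pow]
  obtain ⟨m₀, hm₀⟩ := MvPolynomial.ne_zero_iff.mp hh
  rw [hgc] at hm₀
  have hg0 : g.coeff m₀ ≠ 0 := fun h0 => hm₀ (by simp [h0])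
  have hr0 : (g.coeff m₀).rootMultiplicity 0 = 0 := by
    apply rootMultiplicity_eq_zero
    rw [IsRoot, ← coeff_zero_eq_eval_zero]
    exact hm₀
  have hω : omega0 f = N := by
    apply le_antisymm
    · apply Nat.sInf_le
      refine ⟨m₀, ?_, ?_⟩
      · rw [Finset.mem_coe, MvPolynomial.mem_support_iff, hc]
        exact mul_ne_zero (pow_ne_zero _ X_ne_zero) hg0
      · simp only [hc]
        rw [hrm _ hg0, hr0, add_zero]
    · apply le_csInf
      · refine ⟨_, m₀, ?_, rfl⟩
        rw [Finset.mem_coe, MvPolynomial.mem_support_iff, hc]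
        exact mul_ne_zero (pow_ne_zero _ X_ne_zero) hg0
      · rintro _ ⟨m, hm, rfl⟩
        rw [Finset.mem_coe, MvPolynomial.mem_support_iff, hc] at hm
        simp only [hc]
        rw [hrm _ (right_ne_zero_of_mul hm)]
        omega
  ext m
  rw [initForm, MvPolynomial.coeff_sum]
  simp only [MvPolynomial.coeff_monomial]
  rw [Finset.sum_ite_eq', hω, hgc]
  split_ifs with hm
  · rw [hc]; simpa using coeff_X_pow_mul (g.coeff m) N 0
  · rw [MvPolynomial.notMem_support_iff, hc] at hm
    have : g.coeff m = 0 := (mul_eq_zero.mp hm).resolve_left (pow_ne_zero _ X_ne_zero)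
    simp [this]

theorem l012 (s : ℚ) : LeadT (plucker (GS s) 0 1 2) 5 (-1) (0) := by
  refine ⟨C (1) * X^4 + C (1) * X^9 + C (-1) * X^10 + C (1) * X^12 + C (-1) * X^17, ?_⟩
  have h2 : (C 2 : ℚ[X]) = 2 := rfl
  rw [plucker_GS]
  simp [GS, h2]
  ring

theorem l013 (s : ℚ) : LeadT (plucker (GS s) 0 1 3) 11 (-1) (0) := by
  refine ⟨C (1*s) * X^1 + C (1) * X^4 + C (-1*s) * X^6 + C (1) * X^7 + C (-1) * X^8, ?_⟩
  have h2 : (C 2 : ℚ[X]) = 2 := rfl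
  rw [plucker_GS]
  simp [GS, h2]
  ring

theorem l014 (s : ℚ) : LeadT (plucker (GS s) 0 1 4) 10 (-1) (0) := by
  refine ⟨C (1) * X^4 + C (1) * X^8 + C (1) * X^10 + C (-1) * X^11 + C (-1) * X^13, ?_⟩
  have h2 : (C 2 : ℚ[X]) = 2 := rfl
  rw [plucker_GS]
  simp [GS, h2]
  ring

theorem l023 (s : ℚ) : LeadT (plucker (GS s) 0 2 3) 13 (-1*s) (1) := by
  refine ⟨C (-1) * X^1 + C (1*s) * X^4 + C (1) * X^9 + C (-1) * X^13, ?_⟩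
  have h2 : (C 2 : ℚ[X]) = 2 := rfl
  rw [plucker_GS]
  simp [GS, h2]
  ring

theorem l024 (s : ℚ) : LeadT (plucker (GS s) 0 2 4) 15 (-1) (1) := by
  refine ⟨C (-1) * X^2 + C (1) * X^6 + C (1) * X^8 + C (-1) * X^13, ?_⟩
  have h2 : (C 2 : ℚ[X]) = 2 := rfl
  rw [plucker_GS]
  simp [GS, h2]
  ring

theorem l025 (s : ℚ) : LeadT (plucker (GS s) 0 2 5) 9 (-1) (-1) := by
  refine ⟨C (1) * X^0 + C (1) * X^5 + C (1) * X^6 + C (-1) * X^14, ?_⟩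
  have h2 : (C 2 : ℚ[X]) = 2 := rfl
  rw [plucker_GS]
  simp [GS, h2]
  ring

theorem l034 (s : ℚ) : LeadT (plucker (GS s) 0 3 4) 18 (1*s) (-1) := by
  refine ⟨C (1) * X^2 + C (-1+-1*s) * X^5 + C (1) * X^9, ?_⟩
  have h2 : (C 2 : ℚ[X]) = 2 := rfl
  rw [plucker_GS]
  simp [GS, h2]
  ring

theorem l035 (s : ℚ) : LeadT (plucker (GS s) 0 3 5) 12 (1*s) (-1) := by
  refine ⟨C (-1) * X^2 + C (1) * X^3 + C (1+-1*s) * X^6, ?_⟩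
  have h2 : (C 2 : ℚ[X]) = 2 := rfl
  rw [plucker_GS]
  simp [GS, h2]
  ring

theorem l123 (s : ℚ) : LeadT (plucker (GS s) 1 2 3) 4 (-1*s) (0) := by
  refine ⟨C (1) * X^5 + C (-1) * X^7 + C (1+1*s) * X^9 + C (-1) * X^18, ?_⟩
  have h2 : (C 2 : ℚ[X]) = 2 := rfl
  rw [plucker_GS]
  simp [GS, h2]
  ring

theorem l124 (s : ℚ) : LeadT (plucker (GS s) 1 2 4) 10 (-1) (0) := by
  refine ⟨C (-1) * X^0 + C (1) * X^1 + C (1) * X^2 + C (1) * X^9 + C (-1) * X^14, ?_⟩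
  have h2 : (C 2 : ℚ[X]) = 2 := rfl
  rw [plucker_GS]
  simp [GS, h2]
  ring

theorem l125 (s : ℚ) : LeadT (plucker (GS s) 1 2 5) 1 (-1) (0) := by
  refine ⟨C (-1) * X^3 + C (2) * X^5 + C (1) * X^9 + C (-1) * X^18, ?_⟩
  have h2 : (C 2 : ℚ[X]) = 2 := rfl
  rw [plucker_GS]
  simp [GS, h2]
  ring

theorem l134 (s : ℚ) : LeadT (plucker (GS s) 1 3 4) 9 (1*s) (0) := by
  refine ⟨C (-2) * X^5 + C (1) * X^8 + C (-1*s) * X^10 + C (1) * X^14, ?_⟩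
  have h2 : (C 2 : ℚ[X]) = 2 := rfl
  rw [plucker_GS]
  simp [GS, h2]
  ring

theorem l135 (s : ℚ) : LeadT (plucker (GS s) 1 3 5) 3 (1*s) (0) := by
  refine ⟨C (-1) * X^2 + C (-1) * X^5 + C (1) * X^9 + C (1+-1*s) * X^11, ?_⟩
  have h2 : (C 2 : ℚ[X]) = 2 := rfl
  rw [plucker_GS]
  simp [GS, h2]
  ring

theorem l145 (s : ℚ) : LeadT (plucker (GS s) 1 4 5) 6 (-1) (0) := by
  refine ⟨C (1) * X^1 + C (-1) * X^4 + C (1) * X^5 + C (1) * X^10 + C (-1) * X^14, ?_⟩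
  have h2 : (C 2 : ℚ[X]) = 2 := rfl
  rw [plucker_GS]
  simp [GS, h2]
  ring

theorem l234 (s : ℚ) : LeadT (plucker (GS s) 2 3 4) 14 (1*s) (-1*s) := by
  refine ⟨C (1) * X^3 + C (-1) * X^5 + C (-1) * X^7 + C (1) * X^10, ?_⟩
  have h2 : (C 2 : ℚ[X]) = 2 := rfl
  rw [plucker_GS]
  simp [GS, h2]
  ring

theorem l235 (s : ℚ) : LeadT (plucker (GS s) 2 3 5) 8 (1*s) (0) := by
  refine ⟨C (1+-1*s) * X^0 + C (-1) * X^2 + C (-1) * X^7 + C (1) * X^11, ?_⟩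
  have h2 : (C 2 : ℚ[X]) = 2 := rfl
  rw [plucker_GS]
  simp [GS, h2]
  ring

theorem l245 (s : ℚ) : LeadT (plucker (GS s) 2 4 5) 11 (-1) (1) := by
  refine ⟨C (1) * X^1 + C (-1) * X^3 + C (-1) * X^6 + C (1) * X^7, ?_⟩
  have h2 : (C 2 : ℚ[X]) = 2 := rfl
  rw [plucker_GS]
  simp [GS, h2]
  ring

theorem l345 (s : ℚ) : LeadT (plucker (GS s) 3 4 5) 14 (-1*s) (-1+1*s) := by
  refine ⟨C (2) * X^2 + C (-1) * X^6, ?_⟩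
  have h2 : (C 2 : ℚ[X]) = 2 := rfl
  rw [plucker_GS]
  simp [GS, h2]
  ring

theorem conicGen_eq (M : Matrix (Fin 3) (Fin 6) ℚ[X]) : conicGen M =
    MvPolynomial.C (plucker M 0 1 2 * plucker M 0 1 3 * plucker M 0 1 4 * plucker M 2 3 4) * (yv 0 * yv 1 * xv 2 * xv 3 * xv 4 * xv 5^2) +
    MvPolynomial.C (plucker M 0 1 2 * plucker M 0 2 4 * plucker M 0 2 3 * plucker M 1 3 4) * (yv 0 * yv 2 * xv 1 * xv 3 * xv 4 * xv 5^2) +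
    MvPolynomial.C (plucker M 0 1 3 * plucker M 0 2 3 * plucker M 0 3 4 * plucker M 1 2 4) * (yv 0 * yv 3 * xv 1 * xv 2 * xv 4 * xv 5^2) +
    MvPolynomial.C (plucker M 0 1 4 * plucker M 0 2 4 * plucker M 0 3 4 * plucker M 1 2 3) * (yv 0 * yv 4 * xv 1 * xv 2 * xv 3 * xv 5^2) +
    MvPolynomial.C (plucker M 0 1 2 * plucker M 1 2 3 * plucker M 1 2 4 * plucker M 0 3 4) * (yv 1 * yv 2 * xv 0 * xv 3 * xv 4 * xv 5^2) +
    MvPolynomial.C (plucker M 0 1 3 * plucker M 1 2 3 * plucker M 1 3 4 * plucker M 0 2 4) * (yv 1 * yv 3 * xv 0 * xv 2 * xv 4 * xv 5^2) +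
    MvPolynomial.C (plucker M 0 1 4 * plucker M 1 2 4 * plucker M 1 3 4 * plucker M 0 2 3) * (yv 1 * yv 4 * xv 0 * xv 2 * xv 3 * xv 5^2) +
    MvPolynomial.C (plucker M 0 2 3 * plucker M 1 2 3 * plucker M 2 3 4 * plucker M 0 1 4) * (yv 2 * yv 3 * xv 0 * xv 1 * xv 4 * xv 5^2) +
    MvPolynomial.C (plucker M 0 2 4 * plucker M 1 2 4 * plucker M 2 3 4 * plucker M 0 1 3) * (yv 2 * yv 4 * xv 0 * xv 1 * xv 3 * xv 5^2) +
    MvPolynomial.C (plucker M 0 3 4 * plucker M 1 3 4 * plucker M 2 3 4 * plucker M 0 1 2) * (yv 3 * yv 4 * xv 0 * xv 1 * xv 2 * xv 5^2) +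
    MvPolynomial.C (plucker M 0 1 3 * plucker M 1 2 4 * plucker M 0 2 5 * plucker M 0 3 4 - plucker M 0 1 2 * plucker M 1 3 4 * plucker M 0 3 5 * plucker M 0 2 4) * (yv 0 * yv 5 * xv 1 * xv 2 * xv 3 * xv 4 * xv 5) +
    MvPolynomial.C (plucker M 0 1 3 * plucker M 0 2 4 * plucker M 1 2 5 * plucker M 1 3 4 - plucker M 0 1 2 * plucker M 0 3 4 * plucker M 1 3 5 * plucker M 1 2 4) * (yv 1 * yv 5 * xv 0 * xv 2 * xv 3 * xv 4 * xv 5) +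
    MvPolynomial.C (plucker M 0 2 3 * plucker M 0 1 4 * plucker M 1 2 5 * plucker M 2 3 4 + plucker M 0 1 2 * plucker M 0 3 4 * plucker M 2 3 5 * plucker M 1 2 4) * (yv 2 * yv 5 * xv 0 * xv 1 * xv 3 * xv 4 * xv 5) +
    MvPolynomial.C (plucker M 0 1 3 * plucker M 0 2 4 * plucker M 2 3 5 * plucker M 1 3 4 - plucker M 0 2 3 * plucker M 0 1 4 * plucker M 1 3 5 * plucker M 2 3 4) * (yv 3 * yv 5 * xv 0 * xv 1 * xv 2 * xv 4 * xv 5) +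
    MvPolynomial.C (plucker M 0 1 4 * plucker M 0 2 3 * plucker M 2 4 5 * plucker M 1 3 4 - plucker M 0 2 4 * plucker M 0 1 3 * plucker M 1 4 5 * plucker M 2 3 4) * (yv 4 * yv 5 * xv 0 * xv 1 * xv 2 * xv 3 * xv 5) +
    MvPolynomial.C (plucker M 0 1 3 * plucker M 0 2 4 * plucker M 1 2 5 * plucker M 3 4 5 - plucker M 0 1 2 * plucker M 0 3 4 * plucker M 1 3 5 * plucker M 2 4 5) * (yv 5^2 * xv 0 * xv 1 * xv 2 * xv 3 * xv 4) := by
  simp only [conicGen, cf, map_mul, map_add, map_sub]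

theorem GS_one : GS 1 = Gmat := by simp [GS, Gmat]

theorem GS_neg : GS (-1) = Gmat' := by simp [GS, Gmat']

/-- `p = t^N (e + O(t))`. -/
def HasIn (p : ℚ[X]) (N : ℕ) (e : ℚ) : Prop := ∃ u : ℚ[X], p = X ^ N * u ∧ constantCoeff u = e

theorem LeadT.out0 {p : ℚ[X]} {N : ℕ} {c d e : ℚ} (h : LeadT p N c d) (hc : c = e) : HasIn p N e := by
  obtain ⟨r, rfl⟩ := h
  exact ⟨_, rfl, by simp [hc]⟩

theorem LeadT.out1 {p : ℚ[X]} {N : ℕ} {c d e : ℚ} (h : LeadT p N c d) (hc : c = 0) (hd : d = e) :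
    HasIn p (N + 1) e := by
  obtain ⟨r, rfl⟩ := h
  exact ⟨C d + X * r, by rw [hc, map_zero]; ring, by simp [hd]⟩

theorem conic_init (M : Matrix (Fin 3) (Fin 6) ℚ[X]) (N : ℕ)
    {e0 e1 e2 e3 e4 e5 e6 e7 e8 e9 e10 e11 e12 e13 e14 e15 : ℚ}
    (h0 : HasIn (plucker M 0 1 2 * plucker M 0 1 3 * plucker M 0 1 4 * plucker M 2 3 4) N e0)
    (h1 : HasIn (plucker M 0 1 2 * plucker M 0 2 4 * plucker M 0 2 3 * plucker M 1 3 4) N e1)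
    (h2 : HasIn (plucker M 0 1 3 * plucker M 0 2 3 * plucker M 0 3 4 * plucker M 1 2 4) N e2)
    (h3 : HasIn (plucker M 0 1 4 * plucker M 0 2 4 * plucker M 0 3 4 * plucker M 1 2 3) N e3)
    (h4 : HasIn (plucker M 0 1 2 * plucker M 1 2 3 * plucker M 1 2 4 * plucker M 0 3 4) N e4)
    (h5 : HasIn (plucker M 0 1 3 * plucker M 1 2 3 * plucker M 1 3 4 * plucker M 0 2 4) N e5)
    (h6 : HasIn (plucker M 0 1 4 * plucker M 1 2 4 * plucker M 1 3 4 * plucker M 0 2 3) N e6)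
    (h7 : HasIn (plucker M 0 2 3 * plucker M 1 2 3 * plucker M 2 3 4 * plucker M 0 1 4) N e7)
    (h8 : HasIn (plucker M 0 2 4 * plucker M 1 2 4 * plucker M 2 3 4 * plucker M 0 1 3) N e8)
    (h9 : HasIn (plucker M 0 3 4 * plucker M 1 3 4 * plucker M 2 3 4 * plucker M 0 1 2) N e9)
    (h10 : HasIn (plucker M 0 1 3 * plucker M 1 2 4 * plucker M 0 2 5 * plucker M 0 3 4 - plucker M 0 1 2 * plucker M 1 3 4 * plucker M 0 3 5 * plucker M 0 2 4) N e10)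
    (h11 : HasIn (plucker M 0 1 3 * plucker M 0 2 4 * plucker M 1 2 5 * plucker M 1 3 4 - plucker M 0 1 2 * plucker M 0 3 4 * plucker M 1 3 5 * plucker M 1 2 4) N e11)
    (h12 : HasIn (plucker M 0 2 3 * plucker M 0 1 4 * plucker M 1 2 5 * plucker M 2 3 4 + plucker M 0 1 2 * plucker M 0 3 4 * plucker M 2 3 5 * plucker M 1 2 4) N e12)
    (h13 : HasIn (plucker M 0 1 3 * plucker M 0 2 4 * plucker M 2 3 5 * plucker M 1 3 4 - plucker M 0 2 3 * plucker M 0 1 4 * plucker M 1 3 5 * plucker M 2 3 4) N e13)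
    (h14 : HasIn (plucker M 0 1 4 * plucker M 0 2 3 * plucker M 2 4 5 * plucker M 1 3 4 - plucker M 0 2 4 * plucker M 0 1 3 * plucker M 1 4 5 * plucker M 2 3 4) N e14)
    (h15 : HasIn (plucker M 0 1 3 * plucker M 0 2 4 * plucker M 1 2 5 * plucker M 3 4 5 - plucker M 0 1 2 * plucker M 0 3 4 * plucker M 1 3 5 * plucker M 2 4 5) N e15)
    (h : MvPolynomial (Fin 6 ⊕ Fin 6) ℚ) (hh : MvPolynomial.C e0 * (yq 0 * yq 1 * xq 2 * xq 3 * xq 4 * xq 5^2) +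
      MvPolynomial.C e1 * (yq 0 * yq 2 * xq 1 * xq 3 * xq 4 * xq 5^2) +
      MvPolynomial.C e2 * (yq 0 * yq 3 * xq 1 * xq 2 * xq 4 * xq 5^2) +
      MvPolynomial.C e3 * (yq 0 * yq 4 * xq 1 * xq 2 * xq 3 * xq 5^2) +
      MvPolynomial.C e4 * (yq 1 * yq 2 * xq 0 * xq 3 * xq 4 * xq 5^2) +
      MvPolynomial.C e5 * (yq 1 * yq 3 * xq 0 * xq 2 * xq 4 * xq 5^2) +
      MvPolynomial.C e6 * (yq 1 * yq 4 * xq 0 * xq 2 * xq 3 * xq 5^2) +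
      MvPolynomial.C e7 * (yq 2 * yq 3 * xq 0 * xq 1 * xq 4 * xq 5^2) +
      MvPolynomial.C e8 * (yq 2 * yq 4 * xq 0 * xq 1 * xq 3 * xq 5^2) +
      MvPolynomial.C e9 * (yq 3 * yq 4 * xq 0 * xq 1 * xq 2 * xq 5^2) +
      MvPolynomial.C e10 * (yq 0 * yq 5 * xq 1 * xq 2 * xq 3 * xq 4 * xq 5) +
      MvPolynomial.C e11 * (yq 1 * yq 5 * xq 0 * xq 2 * xq 3 * xq 4 * xq 5) +
      MvPolynomial.C e12 * (yq 2 * yq 5 * xq 0 * xq 1 * xq 3 * xq 4 * xq 5) +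
      MvPolynomial.C e13 * (yq 3 * yq 5 * xq 0 * xq 1 * xq 2 * xq 4 * xq 5) +
      MvPolynomial.C e14 * (yq 4 * yq 5 * xq 0 * xq 1 * xq 2 * xq 3 * xq 5) +
      MvPolynomial.C e15 * (yq 5^2 * xq 0 * xq 1 * xq 2 * xq 3 * xq 4) = h) (h_ne : h ≠ 0) :
    initForm (conicGen M) = h := by
  obtain ⟨u0, g0, rfl⟩ := h0
  obtain ⟨u1, g1, rfl⟩ := h1
  obtain ⟨u2, g2, rfl⟩ := h2
  obtain ⟨u3, g3, rfl⟩ := h3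
  obtain ⟨u4, g4, rfl⟩ := h4
  obtain ⟨u5, g5, rfl⟩ := h5
  obtain ⟨u6, g6, rfl⟩ := h6
  obtain ⟨u7, g7, rfl⟩ := h7
  obtain ⟨u8, g8, rfl⟩ := h8
  obtain ⟨u9, g9, rfl⟩ := h9
  obtain ⟨u10, g10, rfl⟩ := h10
  obtain ⟨u11, g11, rfl⟩ := h11
  obtain ⟨u12, g12, rfl⟩ := h12
  obtain ⟨u13, g13, rfl⟩ := h13
  obtain ⟨u14, g14, rfl⟩ := h14
  obtain ⟨u15, g15, rfl⟩ := h15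
  apply init_of N _ (MvPolynomial.C u0 * (yv 0 * yv 1 * xv 2 * xv 3 * xv 4 * xv 5^2) + MvPolynomial.C u1 * (yv 0 * yv 2 * xv 1 * xv 3 * xv 4 * xv 5^2) + MvPolynomial.C u2 * (yv 0 * yv 3 * xv 1 * xv 2 * xv 4 * xv 5^2) + MvPolynomial.C u3 * (yv 0 * yv 4 * xv 1 * xv 2 * xv 3 * xv 5^2) + MvPolynomial.C u4 * (yv 1 * yv 2 * xv 0 * xv 3 * xv 4 * xv 5^2) + MvPolynomial.C u5 * (yv 1 * yv 3 * xv 0 * xv 2 * xv 4 * xv 5^2) + MvPolynomial.C u6 * (yv 1 * yv 4 * xv 0 * xv 2 * xv 3 * xv 5^2) + MvPolynomial.C u7 * (yv 2 * yv 3 * xv 0 * xv 1 * xv 4 * xv 5^2) + MvPolynomial.C u8 * (yv 2 * yv 4 * xv 0 * xv 1 * xv 3 * xv 5^2) + MvPolynomial.C u9 * (yv 3 * yv 4 * xv 0 * xv 1 * xv 2 * xv 5^2) + MvPolynomial.C u10 * (yv 0 * yv 5 * xv 1 * xv 2 * xv 3 * xv 4 * xv 5) + MvPolynomial.C u11 *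 (yv 1 * yv 5 * xv 0 * xv 2 * xv 3 * xv 4 * xv 5) + MvPolynomial.C u12 * (yv 2 * yv 5 * xv 0 * xv 1 * xv 3 * xv 4 * xv 5) + MvPolynomial.C u13 * (yv 3 * yv 5 * xv 0 * xv 1 * xv 2 * xv 4 * xv 5) + MvPolynomial.C u14 * (yv 4 * yv 5 * xv 0 * xv 1 * xv 2 * xv 3 * xv 5) + MvPolynomial.C u15 * (yv 5^2 * xv 0 * xv 1 * xv 2 * xv 3 * xv 4)) _ _ _ h_ne
  · rw [conicGen_eq, g0, g1, g2, g3, g4, g5, g6, g7, g8, g9, g10, g11, g12, g13, g14, g15]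
    simp only [map_mul]
    ring
  · rw [← hh]
    simp only [map_add, map_mul, map_pow, MvPolynomial.map_C, xv, yv, xq, yq, MvPolynomial.map_X]

theorem xy_ne : (xq 0 * xq 2 * xq 3 * xq 4 * xq 5 * yq 1 * yq 5) ≠ 0 := by
  simp [xq, yq, MvPolynomial.X_ne_zero]

theorem init_G : initForm (conicGen Gmat) =
    MvPolynomial.C (-2) * (xq 0 * xq 2 * xq 3 * xq 4 * xq 5 * yq 1 * yq 5) := by
  rw [← GS_one]
  refine conic_init (GS 1) 36
    ((((((l012 (1)).mul (l013 (1))).mul (l014 (1))).mul (l234 (1))).weak 36 (by norm_num)).out0 (e := 0) (by norm_num))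
    ((((((l012 (1)).mul (l024 (1))).mul (l023 (1))).mul (l134 (1))).weak 36 (by norm_num)).out0 (e := 0) (by norm_num))
    ((((((l013 (1)).mul (l023 (1))).mul (l034 (1))).mul (l124 (1))).weak 36 (by norm_num)).out0 (e := 0) (by norm_num))
    ((((((l014 (1)).mul (l024 (1))).mul (l034 (1))).mul (l123 (1))).weak 36 (by norm_num)).out0 (e := 0) (by norm_num))
    ((((((l012 (1)).mul (l123 (1))).mul (l124 (1))).mul (l034 (1))).weak1 36 (by norm_num)).out0 (e := 0) (by norm_num))
    ((((((l013 (1)).mul (l123 (1))).mul (l134 (1))).mul (l024 (1))).weak 36 (by norm_num)).out0 (e := 0) (by norm_num))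
    ((((((l014 (1)).mul (l124 (1))).mul (l134 (1))).mul (l023 (1))).weak 36 (by norm_num)).out0 (e := 0) (by norm_num))
    ((((((l023 (1)).mul (l123 (1))).mul (l234 (1))).mul (l014 (1))).weak 36 (by norm_num)).out0 (e := 0) (by norm_num))
    ((((((l024 (1)).mul (l124 (1))).mul (l234 (1))).mul (l013 (1))).weak 36 (by norm_num)).out0 (e := 0) (by norm_num))
    ((((((l034 (1)).mul (l134 (1))).mul (l234 (1))).mul (l012 (1))).weak 36 (by norm_num)).out0 (e := 0) (by norm_num))
    (((((((l013 (1)).mul (l124 (1))).mul (l025 (1))).mul (l034 (1))).weak 36 (by norm_num)).sub (((((l012 (1)).mul (l134 (1))).mul (l035 (1))).mul (l024 (1))).weak 36 (by norm_num))).out0 (e := 0) (by norm_num))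
    (((((((l013 (1)).mul (l024 (1))).mul (l125 (1))).mul (l134 (1))).cast 36 (by norm_num)).sub (((((l012 (1)).mul (l034 (1))).mul (l135 (1))).mul (l124 (1))).cast 36 (by norm_num))).out0 (e := -2) (by norm_num))
    (((((((l023 (1)).mul (l014 (1))).mul (l125 (1))).mul (l234 (1))).weak 36 (by norm_num)).add (((((l012 (1)).mul (l034 (1))).mul (l235 (1))).mul (l124 (1))).weak 36 (by norm_num))).out0 (e := 0) (by norm_num))
    (((((((l013 (1)).mul (l024 (1))).mul (l235 (1))).mul (l134 (1))).weak 36 (by norm_num)).sub (((((l023 (1)).mul (l014 (1))).mul (l135 (1))).mul (l234 (1))).weak 36 (by norm_num))).out0 (e := 0) (by norm_num))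
    (((((((l014 (1)).mul (l023 (1))).mul (l245 (1))).mul (l134 (1))).weak 36 (by norm_num)).sub (((((l024 (1)).mul (l013 (1))).mul (l145 (1))).mul (l234 (1))).weak 36 (by norm_num))).out0 (e := 0) (by norm_num))
    (((((((l013 (1)).mul (l024 (1))).mul (l125 (1))).mul (l345 (1))).weak 36 (by norm_num)).sub (((((l012 (1)).mul (l034 (1))).mul (l135 (1))).mul (l245 (1))).weak1 36 (by norm_num))).out0 (e := 0) (by norm_num)) _ ?_ ?_
  · simp only [map_zero, zero_mul, zero_add, add_zero]
    ring
  · exact mul_ne_zero (by simp) xy_ne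

theorem eA : xq 5 ^ 2 * xq 0 * xq 3 * xq 4 * yq 1 * yq 2 = MvPolynomial.monomial
    (Finsupp.single (Sum.inl 5) 2 + Finsupp.single (Sum.inl 0) 1 + Finsupp.single (Sum.inl 3) 1 +
     Finsupp.single (Sum.inl 4) 1 + Finsupp.single (Sum.inr 1) 1 + Finsupp.single (Sum.inr 2) 1)
    (1 : ℚ) := by
  simp [xq, yq, MvPolynomial.X, MvPolynomial.monomial_pow, MvPolynomial.monomial_mul]

theorem eB : xq 0 * xq 2 * xq 3 * xq 4 * xq 5 * yq 1 * yq 5 = MvPolynomial.monomial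
    (Finsupp.single (Sum.inl 0) 1 + Finsupp.single (Sum.inl 2) 1 + Finsupp.single (Sum.inl 3) 1 +
     Finsupp.single (Sum.inl 4) 1 + Finsupp.single (Sum.inl 5) 1 + Finsupp.single (Sum.inr 1) 1 +
     Finsupp.single (Sum.inr 5) 1) (1 : ℚ) := by
  simp [xq, yq, MvPolynomial.X, MvPolynomial.monomial_mul]

theorem eC : xq 0 * xq 1 * xq 2 * xq 3 * xq 4 * yq 5 ^ 2 = MvPolynomial.monomial
    (Finsupp.single (Sum.inl 0) 1 + Finsupp.single (Sum.inl 1) 1 + Finsupp.single (Sum.inl 2) 1 +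
     Finsupp.single (Sum.inl 3) 1 + Finsupp.single (Sum.inl 4) 1 + Finsupp.single (Sum.inr 5) 2)
    (1 : ℚ) := by
  simp [xq, yq, MvPolynomial.X, MvPolynomial.monomial_pow, MvPolynomial.monomial_mul]

theorem supp_three {σ : Type*} [DecidableEq σ] (i : σ) (a b c : σ →₀ ℕ) (x y z : ℚ) (hx : x ≠ 0)
    (hy : y ≠ 0) (hz : z ≠ 0) (hab : a i ≠ b i) (hac : a i ≠ c i) (hbc : b i ≠ c i) :
    (MvPolynomial.C x * MvPolynomial.monomial a (1 : ℚ) +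
      MvPolynomial.C y * MvPolynomial.monomial b (1 : ℚ) +
      MvPolynomial.C z * MvPolynomial.monomial c (1 : ℚ)).support =
    (MvPolynomial.monomial a (1 : ℚ)).support ∪ (MvPolynomial.monomial b (1 : ℚ)).support ∪
      (MvPolynomial.monomial c (1 : ℚ)).support := by
  have h1 : a ≠ b := fun h => hab (by rw [h])
  have h2 : a ≠ c := fun h => hac (by rw [h])
  have h3 : b ≠ c := fun h => hbc (by rw [h])
  ext m
  simp only [Finset.mem_union, MvPolynomial.mem_support_iff, MvPolynomial.coeff_add,
    MvPolynomial.coeff_C_mul, MvPolynomial.coeff_monomial]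
  by_cases ha : a = m
  · subst ha; simp [h1.symm, h2.symm, hx]
  by_cases hb : b = m
  · subst hb; simp [h1, h3.symm, hy]
  by_cases hc : c = m
  · subst hc; simp [h2, h3, hz]
  simp [ha, hb, hc]

theorem supp_G' : (MvPolynomial.C (-1) * (xq 5 ^ 2 * xq 0 * xq 3 * xq 4 * yq 1 * yq 2) +
      MvPolynomial.C (-2) * (xq 0 * xq 2 * xq 3 * xq 4 * xq 5 * yq 1 * yq 5) +
      MvPolynomial.C (-1) * (xq 0 * xq 1 * xq 2 * xq 3 * xq 4 * yq 5 ^ 2)).support =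
      (xq 5 ^ 2 * xq 0 * xq 3 * xq 4 * yq 1 * yq 2).support ∪
      (xq 0 * xq 2 * xq 3 * xq 4 * xq 5 * yq 1 * yq 5).support ∪
      (xq 0 * xq 1 * xq 2 * xq 3 * xq 4 * yq 5 ^ 2).support := by
  rw [eA, eB, eC]
  convert supp_three (Sum.inr 5 : Fin 6 ⊕ Fin 6) _ _ _ _ _ _ _ _ _ _ _ _ using 1
  all_goals simp

theorem init_G' : initForm (conicGen Gmat') =
    MvPolynomial.C (-1) * (xq 5 ^ 2 * xq 0 * xq 3 * xq 4 * yq 1 * yq 2) +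
      MvPolynomial.C (-2) * (xq 0 * xq 2 * xq 3 * xq 4 * xq 5 * yq 1 * yq 5) +
      MvPolynomial.C (-1) * (xq 0 * xq 1 * xq 2 * xq 3 * xq 4 * yq 5 ^ 2) := by
  rw [← GS_neg]
  refine conic_init (GS (-1)) 37
    ((((((l012 (-1)).mul (l013 (-1))).mul (l014 (-1))).mul (l234 (-1))).weak 36 (by norm_num)).out1 (e := 0) (by norm_num) (by norm_num))
    ((((((l012 (-1)).mul (l024 (-1))).mul (l023 (-1))).mul (l134 (-1))).weak 36 (by norm_num)).out1 (e := 0) (by norm_num) (by norm_num))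
    ((((((l013 (-1)).mul (l023 (-1))).mul (l034 (-1))).mul (l124 (-1))).weak 36 (by norm_num)).out1 (e := 0) (by norm_num) (by norm_num))
    ((((((l014 (-1)).mul (l024 (-1))).mul (l034 (-1))).mul (l123 (-1))).weak 36 (by norm_num)).out1 (e := 0) (by norm_num) (by norm_num))
    ((((((l012 (-1)).mul (l123 (-1))).mul (l124 (-1))).mul (l034 (-1))).weak1 36 (by norm_num)).out1 (e := -1) (by norm_num) (by norm_num))
    ((((((l013 (-1)).mul (l123 (-1))).mul (l134 (-1))).mul (l024 (-1))).weak 36 (by norm_num)).out1 (e := 0) (by norm_num) (by norm_num))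
    ((((((l014 (-1)).mul (l124 (-1))).mul (l134 (-1))).mul (l023 (-1))).weak 36 (by norm_num)).out1 (e := 0) (by norm_num) (by norm_num))
    ((((((l023 (-1)).mul (l123 (-1))).mul (l234 (-1))).mul (l014 (-1))).weak 36 (by norm_num)).out1 (e := 0) (by norm_num) (by norm_num))
    ((((((l024 (-1)).mul (l124 (-1))).mul (l234 (-1))).mul (l013 (-1))).weak 36 (by norm_num)).out1 (e := 0) (by norm_num) (by norm_num))
    ((((((l034 (-1)).mul (l134 (-1))).mul (l234 (-1))).mul (l012 (-1))).weak 36 (by norm_num)).out1 (e := 0) (by norm_num) (by norm_num))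
    (((((((l013 (-1)).mul (l124 (-1))).mul (l025 (-1))).mul (l034 (-1))).weak 36 (by norm_num)).sub (((((l012 (-1)).mul (l134 (-1))).mul (l035 (-1))).mul (l024 (-1))).weak 36 (by norm_num))).out1 (e := 0) (by norm_num) (by norm_num))
    (((((((l013 (-1)).mul (l024 (-1))).mul (l125 (-1))).mul (l134 (-1))).cast 36 (by norm_num)).sub (((((l012 (-1)).mul (l034 (-1))).mul (l135 (-1))).mul (l124 (-1))).cast 36 (by norm_num))).out1 (e := -2) (by norm_num) (by norm_num))
    (((((((l023 (-1)).mul (l014 (-1))).mul (l125 (-1))).mul (l234 (-1))).weak 36 (by norm_num)).add (((((l012 (-1)).mul (l034 (-1))).mul (l235 (-1))).mul (l124 (-1))).weak 36 (by norm_num))).out1 (e := 0) (by norm_num) (by norm_num))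
    (((((((l013 (-1)).mul (l024 (-1))).mul (l235 (-1))).mul (l134 (-1))).weak 36 (by norm_num)).sub (((((l023 (-1)).mul (l014 (-1))).mul (l135 (-1))).mul (l234 (-1))).weak 36 (by norm_num))).out1 (e := 0) (by norm_num) (by norm_num))
    (((((((l014 (-1)).mul (l023 (-1))).mul (l245 (-1))).mul (l134 (-1))).weak 36 (by norm_num)).sub (((((l024 (-1)).mul (l013 (-1))).mul (l145 (-1))).mul (l234 (-1))).weak 36 (by norm_num))).out1 (e := 0) (by norm_num) (by norm_num))
    (((((((l013 (-1)).mul (l024 (-1))).mul (l125 (-1))).mul (l345 (-1))).weak 36 (by norm_num)).sub (((((l012 (-1)).mul (l034 (-1))).mul (l135 (-1))).mul (l245 (-1))).weak1 36 (by norm_num))).out1 (e := -1) (by norm_num) (by norm_num)) _ ?_ ?_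
  · simp only [map_zero, zero_mul, zero_add, add_zero]
    ring
  · intro h
    have h2 := supp_G'
    rw [h, MvPolynomial.support_zero] at h2
    have h3 := Finset.union_eq_empty.mp (Finset.union_eq_empty.mp h2.symm).1
    exact xy_ne (MvPolynomial.support_eq_empty.mp h3.2)

/-- (a) The initial form of the conic generator `G₆(G)` is a nonzero rational multiple of
the single monomial `x₁x₃x₄x₅x₆y₂y₆`; (b) the support of the initial form of `G₆(G')`
consists of exactly the three monomials `x₆²x₁x₄x₅y₂y₃`, `x₁x₃x₄x₅x₆y₂y₆`, `x₁x₂x₃x₄x₅y₆²`,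
so `G'` is not moneric. -/
theorem conicGen_initForm :
    (∃ q : ℚ, q ≠ 0 ∧ initForm (conicGen Gmat) =
      MvPolynomial.C q * (xq 0 * xq 2 * xq 3 * xq 4 * xq 5 * yq 1 * yq 5)) ∧
    (initForm (conicGen Gmat')).support =
      (xq 5 ^ 2 * xq 0 * xq 3 * xq 4 * yq 1 * yq 2).support ∪
      (xq 0 * xq 2 * xq 3 * xq 4 * xq 5 * yq 1 * yq 5).support ∪
      (xq 0 * xq 1 * xq 2 * xq 3 * xq 4 * yq 5 ^ 2).support := by
  refine ⟨⟨-2, by norm_num, init_G⟩, ?_⟩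
  rw [init_G']
  exact supp_G'
end
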